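/- arXiv:2404.09946 — 3 statements merged into one kernel-verified Lean document; each statement's English description precedes it below -/
import Mathlib

section
/- (Simulation bound under Lipschitz values for deterministic models) Let M* and M be two discounted MDPs over the same finite state space S ⊆ ℝ^d and finite action space A, with the same reward function R* : S×A → [0, R_max], discount γ ∈ [0,1), deterministic initial state s_init, and deterministic transitions f*, f : S×A → S respectively. Let π : S → Δ(A) be a stochastic policy, and suppose the value function V_M^π of the model M is L-Lipschitz with respect to the Euclidean norm on ℝ^d, i.e., |V_M^π(s) − V_M^π(s̃)| ≤ L‖s − s̃‖ for all s, s̃ ∈ S. Then |J_{M*}(π) − J_M(π)| ≤ (γ/(1−γ)) · L · Σ_{(s,a)} d_{M*}^π(s,a) · ‖f(s,a) − f*(s,a)‖. -/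
open scoped BigOperators

/-- Distribution over states at time `t` induced by following policy `π` under
deterministic transitions `f`, starting from the deterministic initial state `sinit`:
`stateDistDet f π sinit t s = Pr(s_t = s)`. -/
noncomputable def stateDistDet {S A : Type*} [Fintype S] [Fintype A] [DecidableEq S]
    (f : S → A → S) (π : S → A → ℝ) (sinit : S) : ℕ → S → ℝ
  | 0 => fun s => if s = sinit then 1 else 0
  | t + 1 => fun s' =>
      ∑ s : S, ∑ a : A, stateDistDet f π sinit t s * π s a * (if f s a = s' then 1 else 0)

/-- Normalized discounted state-action occupancy for deterministic transitions:
`d^π(s,a) = (1-γ) ∑_t γ^t Pr(s_t = s, a_t = a)`. -/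
noncomputable def occupancyDet {S A : Type*} [Fintype S] [Fintype A] [DecidableEq S]
    (f : S → A → S) (π : S → A → ℝ) (sinit : S) (γ : ℝ) (s : S) (a : A) : ℝ :=
  (1 - γ) * ∑' t : ℕ, γ ^ t * stateDistDet f π sinit t s * π s a

open Finset Filter Topology

section Occupancy

variable {S A : Type*} [Fintype S] [Fintype A] [DecidableEq S]
  {f : S → A → S} {π : S → A → ℝ}

theorem stateDistDet_nonneg (hπ0 : ∀ s a, 0 ≤ π s a) (sinit : S) (t : ℕ) (s : S) :
    0 ≤ stateDistDet f π sinit t s := by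
  induction t generalizing s with
  | zero => simp only [stateDistDet]; split_ifs <;> norm_num
  | succ t ih =>
    simp only [stateDistDet]
    refine sum_nonneg fun x _ => sum_nonneg fun a _ => ?_
    refine mul_nonneg (mul_nonneg (ih x) (hπ0 x a)) ?_
    split_ifs <;> norm_num

/-- The expectation of `h` one step later is the expectation of its one-step average. -/
theorem sum_stateDistDet_succ_mul (sinit : S) (t : ℕ) (h : S → ℝ) :
    ∑ s, stateDistDet f π sinit (t + 1) s * h s =
      ∑ s, stateDistDet f π sinit t s * ∑ a, π s a * h (f s a) := by
  simp only [stateDistDet, sum_mul, mul_sum]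
  rw [sum_comm]
  refine sum_congr rfl fun s _ => ?_
  rw [sum_comm]
  refine sum_congr rfl fun a _ => ?_
  simp [mul_assoc]

theorem sum_stateDistDet (hπ1 : ∀ s, ∑ a, π s a = 1) (sinit : S) (t : ℕ) :
    ∑ s, stateDistDet f π sinit t s = 1 := by
  induction t with
  | zero => simp [stateDistDet]
  | succ t ih =>
    have h := sum_stateDistDet_succ_mul (f := f) (π := π) sinit t fun _ => 1
    simpa [hπ1, ih] using h

theorem stateDistDet_le_one (hπ0 : ∀ s a, 0 ≤ π s a) (hπ1 : ∀ s, ∑ a, π s a = 1)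
    (sinit : S) (t : ℕ) (s : S) : stateDistDet f π sinit t s ≤ 1 := by
  rw [← sum_stateDistDet (f := f) hπ1 sinit t]
  exact single_le_sum (fun x _ => stateDistDet_nonneg hπ0 sinit t x) (mem_univ s)

theorem summable_pow_mul_stateDistDet {γ : ℝ} (hγ0 : 0 ≤ γ) (hγ1 : γ < 1)
    (hπ0 : ∀ s a, 0 ≤ π s a) (hπ1 : ∀ s, ∑ a, π s a = 1) (sinit s : S) :
    Summable fun t => γ ^ t * stateDistDet f π sinit t s :=
  Summable.of_nonneg_of_le
    (fun t => mul_nonneg (pow_nonneg hγ0 t) (stateDistDet_nonneg hπ0 sinit t s))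
    (fun t => mul_le_of_le_one_right (pow_nonneg hγ0 t) (stateDistDet_le_one hπ0 hπ1 sinit t s))
    (summable_geometric_of_lt_one hγ0 hγ1)

theorem occupancyDet_nonneg {γ : ℝ} (hγ0 : 0 ≤ γ) (hγ1 : γ < 1)
    (hπ0 : ∀ s a, 0 ≤ π s a) (sinit s : S) (a : A) :
    0 ≤ occupancyDet f π sinit γ s a :=
  mul_nonneg (sub_nonneg.2 hγ1.le) <| tsum_nonneg fun t =>
    mul_nonneg (mul_nonneg (pow_nonneg hγ0 t) (stateDistDet_nonneg hπ0 sinit t s)) (hπ0 s a)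

/-- Unrolling a Bellman equation for `n` steps. -/
theorem eq_sum_range_add_of_bellman {γ : ℝ} {u : S → ℝ} {c : S → A → ℝ}
    (hu : ∀ s, u s = ∑ a, π s a * (c s a + γ * u (f s a))) (sinit : S) (n : ℕ) :
    u sinit = ∑ t ∈ range n, γ ^ t * ∑ s, stateDistDet f π sinit t s * ∑ a, π s a * c s a +
      γ ^ n * ∑ s, stateDistDet f π sinit n s * u s := by
  induction n with
  | zero => simp [stateDistDet]
  | succ n ih =>
    have key : ∑ s, stateDistDet f π sinit n s * u s =
        ∑ s, stateDistDet f π sinit n s * ∑ a, π s a * c s a +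
          γ * ∑ s, stateDistDet f π sinit (n + 1) s * u s := by
      rw [sum_stateDistDet_succ_mul, mul_sum, ← sum_add_distrib]
      refine sum_congr rfl fun s _ => ?_
      rw [mul_left_comm, ← mul_add, mul_sum, ← sum_add_distrib, hu s]
      congr 1
      exact sum_congr rfl fun a _ => by ring
    rw [sum_range_succ, pow_succ, add_assoc, mul_assoc, ← mul_add, ← key]
    exact ih

/-- The solution of a Bellman equation is the occupancy-weighted sum of its costs. -/
theorem one_sub_mul_eq_sum_occupancyDet {γ : ℝ} (hγ0 : 0 ≤ γ) (hγ1 : γ < 1)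
    (hπ0 : ∀ s a, 0 ≤ π s a) (hπ1 : ∀ s, ∑ a, π s a = 1) {u : S → ℝ} {c : S → A → ℝ}
    (hu : ∀ s, u s = ∑ a, π s a * (c s a + γ * u (f s a))) (sinit : S) :
    (1 - γ) * u sinit = ∑ s, ∑ a, occupancyDet f π sinit γ s a * c s a := by
  have hsum : HasSum
      (fun t => γ ^ t * ∑ s, stateDistDet f π sinit t s * ∑ a, π s a * c s a)
      (∑ s, ∑ a, (∑' t, γ ^ t * stateDistDet f π sinit t s * π s a) * c s a) := by
    have h := hasSum_sum (s := univ) fun s _ => hasSum_sum (s := univ) fun a _ =>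
      (((summable_pow_mul_stateDistDet (f := f) hγ0 hγ1 hπ0 hπ1 sinit s).mul_right
        (π s a)).hasSum.mul_right (c s a))
    refine h.congr_fun fun t => ?_
    simp only [mul_sum]
    exact sum_congr rfl fun s _ => sum_congr rfl fun a _ => by ring
  have htail : Tendsto (fun n => γ ^ n * ∑ s, stateDistDet f π sinit n s * u s)
      atTop (𝓝 0) := by
    have h := tendsto_finsetSum univ fun s _ =>
      (summable_pow_mul_stateDistDet (f := f) hγ0 hγ1 hπ0 hπ1 sinit
        s).tendsto_atTop_zero.mul_const (u s)
    simpa [mul_sum, mul_assoc] using h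
  have hlim := hsum.tendsto_sum_nat.add htail
  simp only [← eq_sum_range_add_of_bellman hu sinit, add_zero] at hlim
  rw [tendsto_nhds_unique tendsto_const_nhds hlim]
  simp only [occupancyDet, mul_sum, mul_assoc]

end Occupancy

/-- **Simulation bound under Lipschitz values for deterministic models**:
the finite state space `S ⊆ ℝ^d` is represented by an injective embedding
`ι : S → ℝ^d`; `M*` and `M` are discounted MDPs with the same rewards `R`,
discount `γ`, initial state `sinit`, and deterministic transitions `fstar`
and `f` respectively.  If the value function `VM = V_M^π` of the model `M`
is `L`-Lipschitz w.r.t. the Euclidean norm, then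
`|J_{M*}(π) - J_M(π)| ≤ γ/(1-γ) · L · ∑_{s,a} d_{M*}^π(s,a) ‖f(s,a) - f*(s,a)‖`. -/
theorem simulation_bound_lipschitz_det
    {S A : Type*} [Fintype S] [Fintype A] [DecidableEq S]
    (d : ℕ) (ι : S → EuclideanSpace ℝ (Fin d)) (hι : Function.Injective ι)
    (γ Rmax L : ℝ) (hγ0 : 0 ≤ γ) (hγ1 : γ < 1)
    (sinit : S)
    (R : S → A → ℝ) (hR0 : ∀ s a, 0 ≤ R s a) (hR1 : ∀ s a, R s a ≤ Rmax)
    (fstar f : S → A → S)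
    (π : S → A → ℝ) (hπ0 : ∀ s a, 0 ≤ π s a) (hπ1 : ∀ s, ∑ a : A, π s a = 1)
    (Vstar VM : S → ℝ)
    (hVstar : ∀ s, Vstar s = ∑ a : A, π s a * (R s a + γ * Vstar (fstar s a)))
    (hVM : ∀ s, VM s = ∑ a : A, π s a * (R s a + γ * VM (f s a)))
    (hLip : ∀ s stilde : S, |VM s - VM stilde| ≤ L * ‖ι s - ι stilde‖) :
    |Vstar sinit - VM sinit| ≤
      γ / (1 - γ) * L *
        ∑ s : S, ∑ a : A, occupancyDet fstar π sinit γ s a * ‖ι (f s a) - ι (fstar s a)‖ := by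
  have hu : ∀ s, Vstar s - VM s = ∑ a, π s a *
      (γ * (VM (fstar s a) - VM (f s a)) + γ * (Vstar (fstar s a) - VM (fstar s a))) := by
    intro s
    rw [hVstar s, hVM s, ← sum_sub_distrib]
    exact sum_congr rfl fun a _ => by ring
  have hid := one_sub_mul_eq_sum_occupancyDet (u := fun s => Vstar s - VM s)
    hγ0 hγ1 hπ0 hπ1 hu sinit
  have hpos : 0 < 1 - γ := sub_pos.2 hγ1
  rw [div_mul_eq_mul_div, div_mul_eq_mul_div, le_div_iff₀ hpos, mul_comm, ← abs_of_pos hpos,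
    ← abs_mul, hid, mul_sum]
  refine (abs_sum_le_sum_abs _ _).trans (sum_le_sum fun s _ => ?_)
  rw [mul_sum]
  refine (abs_sum_le_sum_abs _ _).trans (sum_le_sum fun a _ => ?_)
  have hocc := occupancyDet_nonneg (f := fstar) hγ0 hγ1 hπ0 sinit s a
  rw [abs_mul, abs_mul, abs_of_nonneg hocc, abs_of_nonneg hγ0, abs_sub_comm]
  calc _ ≤ occupancyDet fstar π sinit γ s a *
        (γ * (L * ‖ι (f s a) - ι (fstar s a)‖)) := by
        gcongr
        exact hLip _ _
    _ = _ := by ring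
end

section
/- (Bisimulation abstractions recover the optimal policy) Let M* be a discounted MDP over a finite state space S and finite action space A with transitions P*, rewards R* : S×A → [0, R_max], and discount γ ∈ [0,1). Let X be a finite set, φ* : S → X, and let R*_latent : X×A → ℝ and P*_latent : X×A → Δ(X) satisfy, for all s ∈ S, a ∈ A, x' ∈ X: R*(s,a) = R*_latent(φ*(s),a) and Σ_{s' : φ*(s') = x'} P*(s'|s,a) = P*_latent(x'|φ*(s),a). Let M_latent be the discounted MDP over state space X with transitions P*_latent, rewards R*_latent, and discount γ. Then (i) the optimal value functions satisfy V*_{M*}(s) = V*_{M_latent}(φ*(s)) for all s ∈ S, and (ii) if π_latent is an optimal policy of M_latent, then the lifted policy s ↦ π_latent(φ*(s)) is an optimal policy of M*, i.e., its value function in M* equals V*_{M*}. -/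
open scoped BigOperators

/-- A discounted comparison principle on a finite type: if every uniform bound `f ≤ g + c`
improves to `f ≤ g + γ * c`, then `f ≤ g`. -/
theorem le_of_discounted_improvement {S : Type*} [Finite S] {γ : ℝ} (hγ : γ < 1) {f g : S → ℝ}
    (h : ∀ c, (∀ s, f s ≤ g s + c) → ∀ s, f s ≤ g s + γ * c) (s : S) : f s ≤ g s := by
  have : Nonempty S := ⟨s⟩
  obtain ⟨m, hm⟩ := Finite.exists_max fun s => f s - g s
  have hle : f m ≤ g m + γ * (f m - g m) :=
    h (f m - g m) (fun t => by linarith [hm t]) m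
  nlinarith [hm s]

/-- Averaging against a probability vector preserves a uniform bound `f ≤ g + c`. -/
theorem sum_mul_le_sum_mul_add {S : Type*} [Fintype S] {p f g : S → ℝ} {c : ℝ}
    (hp0 : ∀ s, 0 ≤ p s) (hp1 : ∑ s, p s = 1) (h : ∀ s, f s ≤ g s + c) :
    ∑ s, p s * f s ≤ ∑ s, p s * g s + c :=
  calc ∑ s, p s * f s ≤ ∑ s, p s * (g s + c) :=
        Finset.sum_le_sum fun s _ => mul_le_mul_of_nonneg_left (h s) (hp0 s)
    _ = ∑ s, p s * g s + c := by
        simp only [mul_add, Finset.sum_add_distrib, ← Finset.sum_mul, hp1, one_mul]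

/-- A uniform bound `V ≤ W + c` improves to the bound with `γ * c` between action values. -/
theorem action_value_le_add {S : Type*} [Fintype S] {γ r c : ℝ} {p V W : S → ℝ} (hγ : 0 ≤ γ)
    (hp0 : ∀ s, 0 ≤ p s) (hp1 : ∑ s, p s = 1) (h : ∀ s, V s ≤ W s + c) :
    r + γ * ∑ s, p s * V s ≤ r + γ * ∑ s, p s * W s + γ * c := by
  linarith [mul_le_mul_of_nonneg_left (sum_mul_le_sum_mul_add hp0 hp1 h) hγ]

section BellmanUniqueness

variable {S A : Type*} [Fintype S] [Fintype A] {γ : ℝ} {R : S → A → ℝ} {P : S → A → S → ℝ}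
  {V W : S → ℝ}

theorem bellman_optimality_le [Nonempty A] (hγ0 : 0 ≤ γ) (hγ1 : γ < 1)
    (hP0 : ∀ s a s', 0 ≤ P s a s') (hP1 : ∀ s a, ∑ s', P s a s' = 1)
    (hV : ∀ s, V s = Finset.univ.sup' Finset.univ_nonempty
      (fun a => R s a + γ * ∑ s', P s a s' * V s'))
    (hW : ∀ s, W s = Finset.univ.sup' Finset.univ_nonempty
      (fun a => R s a + γ * ∑ s', P s a s' * W s')) (s : S) : V s ≤ W s := by
  refine le_of_discounted_improvement hγ1 (fun c hc s => ?_) s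
  rw [hV s]
  refine Finset.sup'_le _ _ fun a _ => ?_
  refine (action_value_le_add hγ0 (hP0 s a) (hP1 s a) hc).trans ?_
  rw [hW s]
  exact add_le_add_left
    (Finset.le_sup' (fun a => R s a + γ * ∑ s', P s a s' * W s') (Finset.mem_univ a)) _

theorem bellman_evaluation_le {π : S → A → ℝ} (hγ0 : 0 ≤ γ) (hγ1 : γ < 1)
    (hP0 : ∀ s a s', 0 ≤ P s a s') (hP1 : ∀ s a, ∑ s', P s a s' = 1)
    (hπ0 : ∀ s a, 0 ≤ π s a) (hπ1 : ∀ s, ∑ a, π s a = 1)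
    (hV : ∀ s, V s = ∑ a, π s a * (R s a + γ * ∑ s', P s a s' * V s'))
    (hW : ∀ s, W s = ∑ a, π s a * (R s a + γ * ∑ s', P s a s' * W s')) (s : S) :
    V s ≤ W s := by
  refine le_of_discounted_improvement hγ1 (fun c hc s => ?_) s
  rw [hV s, hW s]
  exact sum_mul_le_sum_mul_add (hπ0 s) (hπ1 s)
    fun a => action_value_le_add hγ0 (hP0 s a) (hP1 s a) hc

end BellmanUniqueness

/-- Averaging a function of `φ s` is averaging against the push-forward weights. -/
theorem sum_mul_comp_eq_sum_fiber {S X : Type*} [Fintype S] [Fintype X] [DecidableEq X]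
    (φ : S → X) {p : S → ℝ} {q : X → ℝ}
    (h : ∀ x, (∑ s, if φ s = x then p s else 0) = q x) (V : X → ℝ) :
    ∑ s, p s * V (φ s) = ∑ x, q x * V x := by
  simp only [← h, Finset.sum_mul, ite_mul, zero_mul]
  rw [Finset.sum_comm]
  simp

/-- **Bisimulation abstractions recover the optimal policy.**
`φ : S → X` is a bisimulation abstraction of the MDP `M* = (Pstar, R, γ)` with
induced abstract model `(Rlat, Plat)`.  Then
(i) the optimal value functions (unique solutions of the Bellman optimality
equations, stated here via `Finset.sup'`, i.e. max over actions) satisfy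
`V*_{M*}(s) = V*_{M_latent}(φ s)` for all `s`; and
(ii) if `πlat` is an optimal policy of `M_latent` (its value function `Vlat`
equals `V*_{M_latent}`), then the value function `Vπ` of the lifted policy
`s ↦ πlat (φ s)` in `M*` equals `V*_{M*}`. -/
theorem bisimulation_recovers_optimal_policy
    {S X A : Type*} [Fintype S] [Fintype X] [Fintype A] [DecidableEq X] [Nonempty A]
    (γ Rmax : ℝ) (hγ0 : 0 ≤ γ) (hγ1 : γ < 1)
    (R : S → A → ℝ) (hR0 : ∀ s a, 0 ≤ R s a) (hR1 : ∀ s a, R s a ≤ Rmax)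
    (Pstar : S → A → S → ℝ)
    (hPstar0 : ∀ s a s', 0 ≤ Pstar s a s') (hPstar1 : ∀ s a, ∑ s' : S, Pstar s a s' = 1)
    (φ : S → X)
    (Rlat : X → A → ℝ) (Plat : X → A → X → ℝ)
    (hPlat0 : ∀ x a x', 0 ≤ Plat x a x') (hPlat1 : ∀ x a, ∑ x' : X, Plat x a x' = 1)
    (hRbisim : ∀ s a, R s a = Rlat (φ s) a)
    (hPbisim : ∀ s a x', (∑ s' : S, if φ s' = x' then Pstar s a s' else 0) = Plat (φ s) a x')
    (VstarS : S → ℝ) (VstarX : X → ℝ)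
    (hVstarS : ∀ s, VstarS s
      = Finset.univ.sup' Finset.univ_nonempty
          (fun a : A => R s a + γ * ∑ s' : S, Pstar s a s' * VstarS s'))
    (hVstarX : ∀ x, VstarX x
      = Finset.univ.sup' Finset.univ_nonempty
          (fun a : A => Rlat x a + γ * ∑ x' : X, Plat x a x' * VstarX x')) :
    (∀ s : S, VstarS s = VstarX (φ s)) ∧
    (∀ πlat : X → A → ℝ, (∀ x a, 0 ≤ πlat x a) → (∀ x, ∑ a : A, πlat x a = 1) →
      ∀ Vlat : X → ℝ,
        (∀ x, Vlat x
          = ∑ a : A, πlat x a * (Rlat x a + γ * ∑ x' : X, Plat x a x' * Vlat x')) →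
        (∀ x, Vlat x = VstarX x) →
        ∀ Vπ : S → ℝ,
          (∀ s, Vπ s
            = ∑ a : A, πlat (φ s) a * (R s a + γ * ∑ s' : S, Pstar s a s' * Vπ s')) →
          ∀ s : S, Vπ s = VstarS s) := by
  have hlift (V : X → ℝ) (s : S) (a : A) :
      R s a + γ * ∑ s', Pstar s a s' * V (φ s')
        = Rlat (φ s) a + γ * ∑ x', Plat (φ s) a x' * V x' := by
    rw [hRbisim, sum_mul_comp_eq_sum_fiber φ (hPbisim s a)]
  have hopt : ∀ s, VstarS s = VstarX (φ s) := by
    have hX : ∀ s, VstarX (φ s) = Finset.univ.sup' Finset.univ_nonempty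
        (fun a => R s a + γ * ∑ s', Pstar s a s' * VstarX (φ s')) := fun s => by
      simp only [hlift]
      exact hVstarX (φ s)
    exact fun s => le_antisymm
      (bellman_optimality_le hγ0 hγ1 hPstar0 hPstar1 hVstarS hX s)
      (bellman_optimality_le hγ0 hγ1 hPstar0 hPstar1 hX hVstarS s)
  refine ⟨hopt, fun πlat hπ0 hπ1 Vlat hVlat hVlatX Vπ hVπ s => ?_⟩
  have hX : ∀ s, Vlat (φ s)
      = ∑ a, πlat (φ s) a * (R s a + γ * ∑ s', Pstar s a s' * Vlat (φ s')) := fun s => by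
    simp only [hlift]
    exact hVlat (φ s)
  rw [hopt s, ← hVlatX]
  exact le_antisymm
    (bellman_evaluation_le hγ0 hγ1 hPstar0 hPstar1
      (fun s => hπ0 (φ s)) (fun s => hπ1 (φ s)) hVπ hX s)
    (bellman_evaluation_le hγ0 hγ1 hPstar0 hPstar1
      (fun s => hπ0 (φ s)) (fun s => hπ1 (φ s)) hX hVπ s)
end

section
/- (Proposition 1, existential form) There exist a finite-horizon MDP M* with horizon H = 2, a data-collection policy π_D, a model M ≠ M* over the same state and action spaces sharing the reward function of M*, and a policy π, such that: (1) the expected multi-step reward-prediction ('MuZero') loss of M is strictly smaller than that of M* (with respect to trajectories generated by M* and π_D, i.e., even in the infinite-data limit), and (2) J_M(π) ≠ J_{M*}(π). -/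
open scoped BigOperators

/-- A finite-horizon MDP with horizon `H = 2` over states `S` and actions `A`:
an initial state, the step-1 transition kernel (the step-2 transition is
irrelevant since the episode ends), and the two reward functions. -/
structure MDP2 (S A : Type*) where
  init : S
  P : S → A → S → ℝ
  R1 : S → A → ℝ
  R2 : S → A → ℝ

/-- The transition kernel consists of probability distributions. -/
def MDP2.IsValid {S A : Type*} [Fintype S] (M : MDP2 S A) : Prop :=
  (∀ s a s', 0 ≤ M.P s a s') ∧ (∀ s a, ∑ s' : S, M.P s a s' = 1)

/-- A stochastic policy: a probability distribution over actions at each state. -/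
def IsPolicy {S A : Type*} [Fintype A] (π : S → A → ℝ) : Prop :=
  (∀ s a, 0 ≤ π s a) ∧ (∀ s, ∑ a : A, π s a = 1)

/-- Expected return `J_M(π) = E[r_1 + r_2]` of policy `π` in the horizon-2 MDP `M`. -/
noncomputable def J2 {S A : Type*} [Fintype S] [Fintype A]
    (M : MDP2 S A) (π : S → A → ℝ) : ℝ :=
  ∑ a1 : A, π M.init a1 *
    (M.R1 M.init a1 + ∑ s2 : S, M.P M.init a1 s2 * ∑ a2 : A, π s2 a2 * M.R2 s2 a2)

/-- Expected multi-step reward-prediction ("MuZero") loss of the model `Mhat`,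
with data trajectories `(s1, a1, r1, s2, a2, r2)` generated by the true MDP
`Mstar` and data-collection policy `πD` (`s1 = Mstar.init`), and the model's
own rollout `shat2 ∼ Mhat.P(·|s1, a1)`.  The per-trajectory loss is
`∑_{h=1}^{2} ∑_{h'=h}^{2} (r_{h'} - r̂_{h'})²`, i.e. the three terms
`(r1 - R̂1(s1,a1))² + (r2 - R̂2(ŝ2,a2))² + (r2 - R̂2(s2,a2))²`. -/
noncomputable def muZeroLoss2 {S A : Type*} [Fintype S] [Fintype A]
    (Mstar Mhat : MDP2 S A) (πD : S → A → ℝ) : ℝ :=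
  ∑ a1 : A, πD Mstar.init a1 *
    ∑ s2 : S, Mstar.P Mstar.init a1 s2 *
      ∑ a2 : A, πD s2 a2 *
        ((Mstar.R1 Mstar.init a1 - Mhat.R1 Mstar.init a1) ^ 2
          + (∑ shat2 : S, Mhat.P Mstar.init a1 shat2 *
              (Mstar.R2 s2 a2 - Mhat.R2 shat2 a2) ^ 2)
          + (Mstar.R2 s2 a2 - Mhat.R2 s2 a2) ^ 2)

/-- The one-action MDP on `Bool` that moves to `true` with probability `p`; the only reward is `1`
at state `true` in step 2. -/
noncomputable def biasedCoinMDP (p : ℝ) : MDP2 Bool Unit where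
  init := false
  P _ _ s := if s then p else 1 - p
  R1 _ _ := 0
  R2 s _ := if s then 1 else 0

theorem biasedCoinMDP_isValid {p : ℝ} (h0 : 0 ≤ p) (h1 : p ≤ 1) :
    (biasedCoinMDP p).IsValid := by
  constructor
  · rintro _ _ (_ | _) <;> simp [biasedCoinMDP, h0, h1]
  · intro _ _
    simp [biasedCoinMDP]

theorem isPolicy_unit {S : Type*} : IsPolicy (fun (_ : S) (_ : Unit) => (1 : ℝ)) := by
  simp [IsPolicy]

theorem J2_biasedCoinMDP (p : ℝ) : J2 (biasedCoinMDP p) (fun _ _ => 1) = p := by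
  simp [J2, biasedCoinMDP]

theorem muZeroLoss2_biasedCoinMDP (p q : ℝ) :
    muZeroLoss2 (biasedCoinMDP p) (biasedCoinMDP q) (fun _ _ => 1) =
      p * (1 - q) + (1 - p) * q := by
  simp [muZeroLoss2, biasedCoinMDP]

/-- **Proposition 1 (existential form).**  There exist a horizon-2 MDP `Mstar`,
a data-collection policy `πD`, a model `M ≠ Mstar` over the same state and
action spaces sharing the rewards (and initial state) of `Mstar`, and a policy
`π`, such that (1) the expected MuZero loss of `M` is strictly smaller than
that of `Mstar` (in the infinite-data limit, i.e. in expectation over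
trajectories from `(Mstar, πD)`), and (2) `J_M(π) ≠ J_{Mstar}(π)`. -/
theorem muzero_loss_fails_in_stochastic_environments :
    ∃ (S A : Type) (iS : Fintype S) (iA : Fintype A)
      (Mstar M : MDP2 S A) (πD π : S → A → ℝ),
      @MDP2.IsValid S A iS Mstar ∧ @MDP2.IsValid S A iS M ∧
      @IsPolicy S A iA πD ∧ @IsPolicy S A iA π ∧
      M ≠ Mstar ∧ M.init = Mstar.init ∧ M.R1 = Mstar.R1 ∧ M.R2 = Mstar.R2 ∧
      @muZeroLoss2 S A iS iA Mstar M πD < @muZeroLoss2 S A iS iA Mstar Mstar πD ∧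
      @J2 S A iS iA M π ≠ @J2 S A iS iA Mstar π := by
  refine ⟨Bool, Unit, inferInstance, inferInstance, biasedCoinMDP (3 / 4), biasedCoinMDP 1,
    fun _ _ => 1, fun _ _ => 1, biasedCoinMDP_isValid (by norm_num) (by norm_num),
    biasedCoinMDP_isValid zero_le_one le_rfl, isPolicy_unit, isPolicy_unit, ?_, rfl, rfl, rfl,
    ?_, ?_⟩
  · intro h
    have hJ := congrArg (fun M => J2 M fun _ _ => 1) h
    norm_num [J2_biasedCoinMDP] at hJ
  · rw [muZeroLoss2_biasedCoinMDP, muZeroLoss2_biasedCoinMDP]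
    norm_num
  · rw [J2_biasedCoinMDP, J2_biasedCoinMDP]
    norm_num
end
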